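/- Assume N ≥ 3 and 1 + 4/(N−2) < p < p_JL. Let Θ : [0,1) × [0,∞) → ℝ be any continuous function such that tan Θ(ρ,c) = ρ ∂_ρ w(ρ,c) / w(ρ,c) whenever w(ρ,c) ≠ 0, Θ(ρ,c) ∈ π/2 + πℤ exactly when w(ρ,c) = 0, and Θ(0,c) = π for all c ≥ 0. Then for every fixed ρ ∈ (0,1), Θ(ρ,c) → −∞ as c → +∞. -/

import Mathlib

open Set Filter

noncomputable def alphaP (p : ℝ) : ℝ := 2 / (p - 1)

noncomputable def b0 (p : ℝ) : ℝ := (2 * (p + 1) / (p - 1) ^ 2) ^ ((1 : ℝ) / (p - 1))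

noncomputable def bInf (N : ℕ) (p : ℝ) : ℝ :=
  (alphaP p * ((N : ℝ) - 2 - alphaP p)) ^ (alphaP p / 2)

noncomputable def uInf (N : ℕ) (p : ℝ) (ρ : ℝ) : ℝ := bInf N p * ρ ^ (-(alphaP p))

/-- `u` solves `(1-ρ²)u'' + ((N-1)/ρ - 2(α+1)ρ)u' - α(α+1)u + |u|^{p-1}u = 0` on `s`. -/
def IsSolOn (N : ℕ) (p : ℝ) (u : ℝ → ℝ) (s : Set ℝ) : Prop :=
  ∀ ρ ∈ s,
    (1 - ρ ^ 2) * deriv (deriv u) ρ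
      + (((N : ℝ) - 1) / ρ - 2 * (alphaP p + 1) * ρ) * deriv u ρ
      - alphaP p * (alphaP p + 1) * u ρ + |u ρ| ^ (p - 1) * u ρ = 0

/-- `w(ρ,c) = u(ρ,c)/u_∞(ρ) - 1`; by Lean's division-by-zero convention this
equals `-1` at `ρ = 0`, matching the convention `w(0,c) = -1`. -/
noncomputable def wFun (N : ℕ) (p : ℝ) (u : ℝ → ℝ → ℝ) (c ρ : ℝ) : ℝ :=
  u c ρ / uInf N p ρ - 1

/-- A real function with derivative `r' ≤ -κ (1 + r²)` lives on an interval of length `< π / κ`. -/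
lemma riccati_length {r r' : ℝ → ℝ} {a b κ : ℝ} (hab : a ≤ b)
    (hr : ∀ s ∈ Icc a b, HasDerivAt r (r' s) s)
    (h : ∀ s ∈ Icc a b, r' s ≤ -(κ * (1 + r s ^ 2))) : κ * (b - a) < Real.pi := by
  have hd : ∀ s ∈ Icc a b, HasDerivAt (fun s => Real.arctan (r s) + κ * s)
      (1 / (1 + r s ^ 2) * r' s + κ * 1) s := fun s hs =>
    ((hr s hs).arctan).add ((hasDerivAt_id s).const_mul κ)
  have hanti : AntitoneOn (fun s => Real.arctan (r s) + κ * s) (Icc a b) := by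
    refine antitoneOn_of_hasDerivWithinAt_nonpos (convex_Icc a b)
      (fun s hs => (hd s hs).continuousAt.continuousWithinAt)
      (fun s hs => (hd s (interior_subset hs)).hasDerivWithinAt) (fun s hs => ?_)
    have h1 := h s (interior_subset hs)
    have h2 : 0 < 1 + r s ^ 2 := by positivity
    have h3 : 1 / (1 + r s ^ 2) * r' s ≤ -κ := by
      rw [one_div, inv_mul_le_iff₀ h2]; linarith
    linarith
  have h1 := hanti (left_mem_Icc.2 hab) (right_mem_Icc.2 hab) hab
  have h2 := Real.arctan_lt_pi_div_two (r a)
  have h3 := Real.neg_pi_div_two_lt_arctan (r b)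
  simp only at h1
  linarith

/-- Lower bound for the secant slope of `z ^ p - z` to the left of `1`. -/
lemma secant_slope_lower {p z : ℝ} (hp : 1 < p) (h0 : 0 < z) (h1 : z < 1) :
    z * (p - 1) / (1 + (p - 1) * (1 - z)) ≤ (z ^ p - z) / (z - 1) := by
  have hz : z ^ p = z * z ^ (p - 1) := by
    rw [← Real.rpow_one_add' h0.le (by linarith)]; congr 1; ring
  have hx : 0 < (p - 1) * (1 - z) := mul_pos (by linarith) (by linarith)
  have hle : z ^ (p - 1) ≤ 1 / (1 + (p - 1) * (1 - z)) := by
    rw [Real.rpow_def_of_pos h0, le_div_iff₀ (by linarith)]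
    have hl : Real.log z ≤ z - 1 := Real.log_le_sub_one_of_pos h0
    have h2 : Real.log z * (p - 1) ≤ -((p - 1) * (1 - z)) := by nlinarith
    have h3 : 1 + (p - 1) * (1 - z) ≤ Real.exp ((p - 1) * (1 - z)) := by
      linarith [Real.add_one_le_exp ((p - 1) * (1 - z))]
    calc Real.exp (Real.log z * (p - 1)) * (1 + (p - 1) * (1 - z))
        ≤ Real.exp (-((p - 1) * (1 - z))) * Real.exp ((p - 1) * (1 - z)) := by gcongr
      _ = 1 := by rw [← Real.exp_add]; simp
  have hrw : (z ^ p - z) / (z - 1) = z * (1 - z ^ (p - 1)) / (1 - z) := by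
    rw [hz, div_eq_div_iff (by linarith) (by linarith)]; ring
  rw [hrw, mul_div_assoc, mul_div_assoc]
  refine mul_le_mul_of_nonneg_left ?_ h0.le
  rw [le_div_iff₀ (by linarith)]
  have : (p - 1) / (1 + (p - 1) * (1 - z)) * (1 - z) = 1 - 1 / (1 + (p - 1) * (1 - z)) := by
    field_simp; ring
  linarith

lemma secant_slope_lower_of_one_lt {p z : ℝ} (hp : 1 < p) (h1 : 1 < z) :
    p - 1 ≤ (z ^ p - z) / (z - 1) := by
  rw [le_div_iff₀ (by linarith)]
  have := one_add_mul_self_le_rpow_one_add (s := z - 1) (by linarith) hp.le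
  rw [add_sub_cancel] at this
  linarith

/-- Negativity of the discriminant persists under small perturbations of the coefficients. -/
lemma exists_quadratic_gap {B K p : ℝ} (hB : 0 < B)
    (hdisc : B ^ 2 < 4 * (K * (p - 1))) :
    ∃ t : ℝ, 0 < t ∧ t < 1 / 4 ∧ ∀ x, 0 ≤ x → x ≤ t → ∀ r : ℝ,
      t * (1 + r ^ 2) ≤ (1 - x) * r ^ 2 + (B - x) * r +
        K * ((1 - t) * (p - 1) / (1 + (p - 1) * t)) := by
  have hc : ContinuousAt (fun t : ℝ => 4 * (1 - 2 * t) *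
      (K * ((1 - t) * (p - 1) / (1 + (p - 1) * t)) - t) - (B + t) ^ 2) 0 := by
    have : (1 + (p - 1) * (0 : ℝ)) ≠ 0 := by simp
    fun_prop (disch := assumption)
  have h0 := hc.eventually (lt_mem_nhds (a := 0) (by simp; linarith))
  have h1 : ∀ᶠ t in nhdsWithin (0 : ℝ) (Ioi 0), t ∈ Ioo (0 : ℝ) (1 / 4) :=
    Ioo_mem_nhdsGT (by norm_num)
  obtain ⟨t, ht, ht0, ht1⟩ := ((h0.filter_mono nhdsWithin_le_nhds).and h1).exists
  refine ⟨t, ht0, ht1, fun x hx0 hxt r => ?_⟩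
  set Q := K * ((1 - t) * (p - 1) / (1 + (p - 1) * t))
  have h2 : (B - x) ^ 2 ≤ (B + t) ^ 2 := by
    apply sq_le_sq'
    · linarith
    · linarith
  have h3 : 0 ≤ 4 * (1 - 2 * t) * ((1 - 2 * t) * r ^ 2 + (B - x) * r + (Q - t)) := by
    nlinarith [sq_nonneg (2 * (1 - 2 * t) * r + (B - x))]
  have h4 : 0 ≤ (1 - 2 * t) * r ^ 2 + (B - x) * r + (Q - t) :=
    nonneg_of_mul_nonneg_right h3 (by linarith)
  nlinarith [mul_nonneg (sub_nonneg.2 hxt) (sq_nonneg r)]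

/-- The profile equation in the variable `s = log ρ` for `Z = u / u_∞`. -/
structure LogProfile (B K p : ℝ) (Z Z₁ Z₂ : ℝ → ℝ) : Prop where
  deriv_fst : ∀ s < 0, HasDerivAt Z (Z₁ s) s
  deriv_snd : ∀ s < 0, HasDerivAt Z₁ (Z₂ s) s
  eqn : ∀ s < 0, (1 - Real.exp s ^ 2) * Z₂ s + (B - Real.exp s ^ 2) * Z₁ s
    + K * (|Z s| ^ (p - 1) * Z s - Z s) = 0

namespace LogProfile

variable {B K p : ℝ} {Z Z₁ Z₂ : ℝ → ℝ}

lemma exp_sq_lt_one {s : ℝ} (hs : s < 0) : Real.exp s ^ 2 < 1 := by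
  rw [← Real.exp_nat_mul]
  calc Real.exp ((2 : ℕ) * s) < Real.exp 0 := Real.exp_lt_exp.2 (by push_cast; linarith)
    _ = 1 := Real.exp_zero

lemma exp_sq_le_of_le {s x : ℝ} (hx : 0 < x) (hs : s ≤ Real.log x / 2) : Real.exp s ^ 2 ≤ x := by
  rw [← Real.exp_nat_mul]
  calc Real.exp ((2 : ℕ) * s) ≤ Real.exp (Real.log x) := Real.exp_le_exp.2 (by push_cast; linarith)
    _ = x := Real.exp_log hx

lemma hasDerivAt_ratio (h : LogProfile B K p Z Z₁ Z₂) {s : ℝ} (hs : s < 0) (h1 : Z s ≠ 1) :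
    HasDerivAt (fun s => Z₁ s / (Z s - 1)) (Z₂ s / (Z s - 1) - (Z₁ s / (Z s - 1)) ^ 2) s := by
  have h1' : Z s - 1 ≠ 0 := sub_ne_zero.2 h1
  refine ((h.deriv_snd s hs).div ((h.deriv_fst s hs).sub_const 1) h1').congr_deriv ?_
  field_simp

lemma ratio_eqn (h : LogProfile B K p Z Z₁ Z₂) (hp : 1 < p) {s : ℝ} (hs : s < 0) (h0 : 0 < Z s)
    (h1 : Z s ≠ 1) :
    (1 - Real.exp s ^ 2) * (Z₂ s / (Z s - 1) - (Z₁ s / (Z s - 1)) ^ 2) =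
      -((1 - Real.exp s ^ 2) * (Z₁ s / (Z s - 1)) ^ 2
        + (B - Real.exp s ^ 2) * (Z₁ s / (Z s - 1))
        + K * ((Z s ^ p - Z s) / (Z s - 1))) := by
  have h1' : Z s - 1 ≠ 0 := sub_ne_zero.2 h1
  have he := h.eqn s hs
  have hz : |Z s| ^ (p - 1) * Z s = Z s ^ p := by
    rw [abs_of_pos h0, ← Real.rpow_add_one' h0.le (by linarith)]; congr 1; ring
  rw [hz] at he
  field_simp
  linear_combination (Z s - 1) * he

/-- A lower bound on the quadratic form gives the Riccati inequality. -/
lemma ratio_deriv_le (h : LogProfile B K p Z Z₁ Z₂) (hp : 1 < p) {s κ : ℝ} (hs : s < 0)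
    (h0 : 0 < Z s) (h1 : Z s ≠ 1) (hκ : 0 ≤ κ)
    (hq : κ * (1 + (Z₁ s / (Z s - 1)) ^ 2) ≤ (1 - Real.exp s ^ 2) * (Z₁ s / (Z s - 1)) ^ 2
        + (B - Real.exp s ^ 2) * (Z₁ s / (Z s - 1)) + K * ((Z s ^ p - Z s) / (Z s - 1))) :
    Z₂ s / (Z s - 1) - (Z₁ s / (Z s - 1)) ^ 2 ≤ -(κ * (1 + (Z₁ s / (Z s - 1)) ^ 2)) := by
  have he := h.ratio_eqn hp hs h0 h1
  have hx := exp_sq_lt_one hs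
  have hx0 : 0 ≤ Real.exp s ^ 2 := by positivity
  set D := Z₂ s / (Z s - 1) - (Z₁ s / (Z s - 1)) ^ 2
  have h2 : (1 - Real.exp s ^ 2) * D ≤ -(κ * (1 + (Z₁ s / (Z s - 1)) ^ 2)) := by linarith
  have h3 : 0 ≤ κ * (1 + (Z₁ s / (Z s - 1)) ^ 2) := by positivity
  have h4 : D ≤ 0 := by
    by_contra hD
    push Not at hD
    have := mul_pos (sub_pos.2 hx) hD
    linarith
  nlinarith [mul_nonneg hx0 (neg_nonneg.2 h4)]

/-- Solutions bounded away from `0` cross the value `1` within a uniform time. -/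
theorem exists_uniform_crossing (hB : 0 < B) (hK : 0 < K) (hp : 1 < p)
    (hdisc : B ^ 2 < 4 * (K * (p - 1))) {δ : ℝ} (hδ : 0 < δ) :
    ∃ σ < 0, ∃ T > 0, ∀ Z Z₁ Z₂ : ℝ → ℝ, LogProfile B K p Z Z₁ Z₂ → ∀ a, a + T ≤ σ →
      (∀ s ∈ Icc a (a + T), δ ≤ Z s) → ∃ s ∈ Icc a (a + T), Z s = 1 := by
  obtain ⟨t, ht0, ht1, hgap⟩ := exists_quadratic_gap hB hdisc
  set q₀ := δ * (p - 1) / p with hq₀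
  have hq₀pos : 0 < q₀ := div_pos (mul_pos hδ (by linarith)) (by linarith)
  set η := K * q₀ / (2 * B) with hη
  have hηpos : 0 < η := by positivity
  set κ₁ := min (1 / 2) (K * q₀ / 2) with hκ₁
  have hκ₁pos : 0 < κ₁ := lt_min (by norm_num) (by positivity)
  have hpi := Real.pi_pos
  set T₂ := -Real.log t / η with hT₂
  have hT₂pos : 0 < T₂ := div_pos (neg_pos.2 (Real.log_neg ht0 (by linarith))) hηpos
  have hT₁pos : 0 < Real.pi / κ₁ := by positivity
  have hT₃pos : 0 < Real.pi / t := by positivity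
  have hm0 : 0 < min t B := lt_min ht0 hB
  refine ⟨Real.log (min t B) / 2, ?_, Real.pi / κ₁ + T₂ + Real.pi / t, by positivity, ?_⟩
  · have := Real.log_neg hm0 ((min_le_left _ _).trans_lt (by linarith))
    linarith
  intro Z Z₁ Z₂ h a ha hZ
  set b := a + (Real.pi / κ₁ + T₂ + Real.pi / t) with hb
  by_contra! hne
  have hσ0 : Real.log (min t B) / 2 < 0 := by
    have := Real.log_neg hm0 ((min_le_left _ _).trans_lt (by linarith))
    linarith
  have hs0 : ∀ s ∈ Icc a b, s < 0 := fun s hs => (hs.2.trans ha).trans_lt hσ0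
  have hx : ∀ s ∈ Icc a b, Real.exp s ^ 2 ≤ min t B := fun s hs =>
    exp_sq_le_of_le hm0 (hs.2.trans ha)
  have hpos : ∀ s ∈ Icc a b, 0 < Z s := fun s hs => hδ.trans_le (hZ s hs)
  have hcont : ContinuousOn Z (Icc a b) := fun s hs =>
    (h.deriv_fst s (hs0 s hs)).continuousAt.continuousWithinAt
  have hslope : (1 - t) * (p - 1) / (1 + (p - 1) * t) ≤ p - 1 := by
    have : 0 < (p - 1) * t := mul_pos (by linarith) ht0
    rw [div_le_iff₀ (by linarith)]
    nlinarith [mul_pos this (sub_pos.2 hp)]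
  -- no solution can stay in the region of fast rotation
  have fast : ∀ s₂, a ≤ s₂ → s₂ + Real.pi / t ≤ b →
      (∀ s ∈ Icc s₂ (s₂ + Real.pi / t),
        (1 - t) * (p - 1) / (1 + (p - 1) * t) ≤ (Z s ^ p - Z s) / (Z s - 1)) → False := by
    intro s₂ h2 h2b hq
    have hsub : ∀ s ∈ Icc s₂ (s₂ + Real.pi / t), s ∈ Icc a b := fun s hs =>
      ⟨h2.trans hs.1, hs.2.trans h2b⟩
    have := riccati_length (κ := t) (a := s₂) (b := s₂ + Real.pi / t) (by linarith)
      (fun s hs => h.hasDerivAt_ratio (hs0 s (hsub s hs)) (hne s (hsub s hs)))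
      (fun s hs => by
        refine h.ratio_deriv_le hp (hs0 s (hsub s hs)) (hpos s (hsub s hs)) (hne s (hsub s hs))
          ht0.le ?_
        refine (hgap (Real.exp s ^ 2) (by positivity)
          ((hx s (hsub s hs)).trans (min_le_left _ _)) _).trans ?_
        have := mul_le_mul_of_nonneg_left (hq s hs) hK.le
        linarith)
    rw [add_sub_cancel_left, mul_div_cancel₀ _ ht0.ne'] at this
    exact lt_irrefl _ this
  have hab : a ≤ b := by rw [hb]; linarith
  rcases lt_or_gt_of_ne (hne a (left_mem_Icc.2 hab)) with hlt | hgt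
  swap
  · refine fast a le_rfl (by rw [hb]; linarith) (fun s hs => ?_)
    have hsub : s ∈ Icc a b := ⟨hs.1, hs.2.trans (by rw [hb]; linarith)⟩
    refine hslope.trans (secant_slope_lower_of_one_lt hp ?_)
    by_contra! hle
    obtain ⟨y, hy, hy1⟩ := intermediate_value_Icc' hs.1
      (hcont.mono (Icc_subset_Icc le_rfl hsub.2)) ⟨hle, hgt.le⟩
    exact hne y ⟨hy.1, hy.2.trans hsub.2⟩ hy1
  have hlt1 : ∀ s ∈ Icc a b, Z s < 1 := by
    intro s hsub
    by_contra! hle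
    obtain ⟨y, hy, hy1⟩ := intermediate_value_Icc hsub.1
      (hcont.mono (Icc_subset_Icc le_rfl hsub.2)) ⟨hlt.le, hle⟩
    exact hne y ⟨hy.1, hy.2.trans hsub.2⟩ hy1
  have hqlow : ∀ s ∈ Icc a b, q₀ ≤ (Z s ^ p - Z s) / (Z s - 1) := by
    intro s hs
    have h0 := hpos s hs
    have h1 := hlt1 s hs
    refine le_trans ?_ (secant_slope_lower hp h0 h1)
    have hp1 : 0 < p - 1 := by linarith
    have : 0 < (p - 1) * (1 - Z s) := mul_pos hp1 (by linarith)
    apply div_le_div₀ (by positivity)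
      (mul_le_mul_of_nonneg_right (hZ s hs) hp1.le) (by linarith)
    nlinarith
  have slow : ∀ s ∈ Icc a b, -η ≤ Z₁ s / (Z s - 1) →
      Z₂ s / (Z s - 1) - (Z₁ s / (Z s - 1)) ^ 2 ≤ -(κ₁ * (1 + (Z₁ s / (Z s - 1)) ^ 2)) := by
    intro s hs hr
    refine h.ratio_deriv_le hp (hs0 s hs) (hpos s hs) (hne s hs) hκ₁pos.le ?_
    have hx1 := (hx s hs).trans (min_le_left _ _)
    have hx2 := (hx s hs).trans (min_le_right _ _)
    have hx3 : 0 ≤ Real.exp s ^ 2 := by positivity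
    have hKq := mul_le_mul_of_nonneg_left (hqlow s hs) hK.le
    set r := Z₁ s / (Z s - 1)
    set x := Real.exp s ^ 2
    have hBη : B * η = K * q₀ / 2 := by rw [hη]; field_simp
    have e1 : -(K * q₀ / 2) ≤ (B - x) * r := by
      rw [← hBη]
      nlinarith [mul_le_mul_of_nonneg_left hr (sub_nonneg.2 hx2), mul_nonneg hx3 hηpos.le]
    have e2 : 1 / 2 * r ^ 2 ≤ (1 - x) * r ^ 2 :=
      mul_le_mul_of_nonneg_right (by linarith) (sq_nonneg r)
    have e3 : κ₁ * r ^ 2 ≤ 1 / 2 * r ^ 2 :=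
      mul_le_mul_of_nonneg_right (min_le_left _ _) (sq_nonneg r)
    have e4 : κ₁ ≤ K * q₀ / 2 := min_le_right _ _
    linarith
  have hder : ∀ s ∈ Icc a b, HasDerivAt (fun s => Z₁ s / (Z s - 1))
      (Z₂ s / (Z s - 1) - (Z₁ s / (Z s - 1)) ^ 2) s := fun s hs =>
    h.hasDerivAt_ratio (hs0 s hs) (hne s hs)
  obtain ⟨s₁, hs₁, hr₁⟩ : ∃ s₁ ∈ Icc a (a + Real.pi / κ₁), Z₁ s₁ / (Z s₁ - 1) < -η := by
    by_contra! hge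
    have hsub : ∀ s ∈ Icc a (a + Real.pi / κ₁), s ∈ Icc a b := fun s hs =>
      ⟨hs.1, hs.2.trans (by rw [hb]; linarith)⟩
    have := riccati_length (κ := κ₁) (a := a) (b := a + Real.pi / κ₁) (by linarith)
      (fun s hs => hder s (hsub s hs)) (fun s hs => slow s (hsub s hs) (hge s hs))
    rw [add_sub_cancel_left, mul_div_cancel₀ _ hκ₁pos.ne'] at this
    exact lt_irrefl _ this
  have hsub₁ : ∀ s ∈ Icc s₁ b, s ∈ Icc a b := fun s hs => ⟨hs₁.1.trans hs.1, hs.2⟩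
  have hrle : ∀ ⦃s⦄, s ∈ Icc s₁ b → Z₁ s / (Z s - 1) ≤ -η := by
    refine image_le_of_deriv_right_lt_deriv_boundary (B := fun _ => -η) (B' := fun _ => 0)
      (fun s hs => (hder s (hsub₁ s hs)).continuousAt.continuousWithinAt)
      (fun s hs => (hder s (hsub₁ s (Ico_subset_Icc_self hs))).hasDerivWithinAt) hr₁.le
      (fun s => hasDerivAt_const s _) (fun s hs he => ?_)
    have := slow s (hsub₁ s (Ico_subset_Icc_self hs)) he.ge
    have hp' : 0 < κ₁ * (1 + (Z₁ s / (Z s - 1)) ^ 2) := by positivity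
    linarith
  have hd : ∀ s ∈ Icc s₁ b, HasDerivAt (fun s => Real.log (1 - Z s) + η * s)
      (-Z₁ s / (1 - Z s) + η * 1) s := fun s hs => by
    have hs' := hsub₁ s hs
    have hz := hlt1 s hs'
    exact (((h.deriv_fst s (hs0 s hs')).const_sub 1).log (by linarith)).add
      ((hasDerivAt_id s).const_mul η)
  have hanti : AntitoneOn (fun s => Real.log (1 - Z s) + η * s) (Icc s₁ b) := by
    refine antitoneOn_of_hasDerivWithinAt_nonpos (convex_Icc _ _)
      (fun s hs => (hd s hs).continuousAt.continuousWithinAt)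
      (fun s hs => (hd s (interior_subset hs)).hasDerivWithinAt) (fun s hs => ?_)
    have h1 := hrle (interior_subset hs)
    have h2 : -Z₁ s / (1 - Z s) = Z₁ s / (Z s - 1) := by
      rw [← neg_sub (Z s) 1, neg_div_neg_eq]
    rw [h2]; linarith
  refine fast (s₁ + T₂) (by linarith [hs₁.1]) (by rw [hb]; linarith [hs₁.2]) (fun s hs => ?_)
  have hsb : s ∈ Icc s₁ b := ⟨by linarith [hs.1], hs.2.trans (by rw [hb]; linarith [hs₁.2])⟩
  have hl := hanti (left_mem_Icc.2 (hsb.1.trans hsb.2)) hsb hsb.1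
  simp only at hl
  have hz0 := hpos s (hsub₁ s hsb)
  have hz1 := hlt1 s (hsub₁ s hsb)
  have hl1 : Real.log (1 - Z s₁) ≤ 0 := by
    have hs₁b := hsub₁ s₁ (left_mem_Icc.2 (hsb.1.trans hsb.2))
    exact Real.log_nonpos (by linarith [hlt1 s₁ hs₁b]) (by linarith [hpos s₁ hs₁b])
  have hl2 : Real.log (1 - Z s) ≤ Real.log t := by
    have e : η * T₂ = -Real.log t := by rw [hT₂]; field_simp
    nlinarith [mul_le_mul_of_nonneg_left hs.1 hηpos.le]
  have hzt : 1 - Z s ≤ t := (Real.log_le_log_iff (by linarith) ht0).1 hl2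
  refine le_trans ?_ (secant_slope_lower hp hz0 hz1)
  have hp1 : 0 < p - 1 := by linarith
  have hq1 : 0 < (p - 1) * (1 - Z s) := mul_pos hp1 (by linarith)
  apply div_le_div₀ (by positivity) (mul_le_mul_of_nonneg_right (by linarith) hp1.le)
    (by linarith)
  gcongr


/-- The dissipated energy of the profile equation in logarithmic variables. -/
noncomputable def energy (K p : ℝ) (Z Z₁ : ℝ → ℝ) (s : ℝ) : ℝ :=
  (1 - Real.exp s ^ 2) * Z₁ s ^ 2 / 2 + K * (|Z s| ^ (p + 1) / (p + 1) - Z s ^ 2 / 2)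


lemma hasDerivAt_energy (h : LogProfile B K p Z Z₁ Z₂) (hp : 1 < p) {s : ℝ} (hs : s < 0) :
    HasDerivAt (energy K p Z Z₁) (-(B * Z₁ s ^ 2)) s := by
  have hZ := h.deriv_fst s hs
  have hZ₁ := h.deriv_snd s hs
  have hE := ((Real.hasDerivAt_exp s).pow 2).const_sub 1
  have hA := (hasDerivAt_abs_rpow (Z s) (p := p + 1) (by linarith)).comp s hZ
  have hk := ((hE.mul (hZ₁.pow 2)).div_const 2).add
    (((hA.div_const (p + 1)).sub ((hZ.pow 2).div_const 2)).const_mul K)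
  refine (hk.congr_deriv ?_)
  have he := h.eqn s hs
  have hp1 : p + 1 - 2 = p - 1 := by ring
  have hp2 : p + 1 ≠ 0 := by linarith
  simp only [hp1, Pi.pow_apply]
  field_simp
  push_cast
  ring_nf at he ⊢
  linear_combination 2 * Z₁ s * he

lemma antitoneOn_energy (h : LogProfile B K p Z Z₁ Z₂) (hB : 0 < B) (hp : 1 < p) :
    AntitoneOn (energy K p Z Z₁) (Iio 0) := by
  refine antitoneOn_of_hasDerivWithinAt_nonpos (convex_Iio 0)
    (fun s hs => (h.hasDerivAt_energy hp hs).continuousAt.continuousWithinAt)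
    (fun s hs => (h.hasDerivAt_energy hp (by simpa using hs)).hasDerivWithinAt) (fun s hs => ?_)
  have : 0 ≤ B * Z₁ s ^ 2 := by positivity
  linarith

lemma potential_lower {p : ℝ} (hp : 1 < p) (z : ℝ) :
    1 / (p + 1) - 1 / 2 ≤ |z| ^ (p + 1) / (p + 1) - z ^ 2 / 2 := by
  have h := one_add_mul_self_le_rpow_one_add (s := z ^ 2 - 1) (by nlinarith [sq_nonneg z])
    (p := (p + 1) / 2) (by linarith)
  have e : (1 + (z ^ 2 - 1)) ^ ((p + 1) / 2) = |z| ^ (p + 1) := by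
    rw [add_sub_cancel, ← sq_abs, ← Real.rpow_natCast, ← Real.rpow_mul (abs_nonneg z)]
    congr 1; push_cast; ring
  rw [e] at h
  have h2 : (1 + (p + 1) / 2 * (z ^ 2 - 1)) / (p + 1) ≤ |z| ^ (p + 1) / (p + 1) := by
    gcongr
  have h3 : (1 + (p + 1) / 2 * (z ^ 2 - 1)) / (p + 1) = 1 / (p + 1) + (z ^ 2 - 1) / 2 := by
    have : p + 1 ≠ 0 := by linarith
    field_simp
  linarith

/-- A solution emanating from `0` is never tangent to the constant solution `1`. -/
lemma deriv_ne_zero_of_eq_one (h : LogProfile B K p Z Z₁ Z₂) (hB : 0 < B) (hK : 0 < K)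
    (hp : 1 < p) (hlim : Tendsto Z atBot (nhds 0)) {s₁ : ℝ} (hs₁ : s₁ < 0) (h1 : Z s₁ = 1) :
    Z₁ s₁ ≠ 0 := by
  intro h0
  have hx1 := exp_sq_lt_one hs₁
  set C := 2 * B / (1 - Real.exp s₁ ^ 2) with hC
  set m := K * (1 / (p + 1) - 1 / 2) with hm
  have hd : ∀ s ≤ s₁, HasDerivAt (fun s => (energy K p Z Z₁ s - m) * Real.exp (C * s))
      (-(B * Z₁ s ^ 2) * Real.exp (C * s)
        + (energy K p Z Z₁ s - m) * (Real.exp (C * s) * (C * 1))) s := fun s hs =>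
    ((h.hasDerivAt_energy hp (hs.trans_lt hs₁)).sub_const m).mul
      ((hasDerivAt_id s).const_mul C).exp
  have hmono : MonotoneOn (fun s => (energy K p Z Z₁ s - m) * Real.exp (C * s)) (Iic s₁) := by
    refine monotoneOn_of_hasDerivWithinAt_nonneg (convex_Iic _)
      (fun s hs => (hd s hs).continuousAt.continuousWithinAt)
      (fun s hs => (hd s (by rw [interior_Iic] at hs; exact le_of_lt hs)).hasDerivWithinAt) (fun s hs => ?_)
    have hs' : s ≤ s₁ := interior_subset (s := Iic s₁) hs
    have hpot := mul_le_mul_of_nonneg_left (potential_lower hp (Z s)) hK.le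
    have hexp : Real.exp s ^ 2 ≤ Real.exp s₁ ^ 2 := by gcongr
    have e1 : (1 - Real.exp s₁ ^ 2) * Z₁ s ^ 2 / 2 ≤ energy K p Z Z₁ s - m := by
      have : (1 - Real.exp s₁ ^ 2) * Z₁ s ^ 2 ≤ (1 - Real.exp s ^ 2) * Z₁ s ^ 2 := by gcongr
      unfold energy
      linarith
    have hC0 : 0 ≤ C := div_nonneg (by linarith) (by linarith)
    have e2 : B * Z₁ s ^ 2 ≤ C * (energy K p Z Z₁ s - m) := by
      refine le_trans (le_of_eq ?_) (mul_le_mul_of_nonneg_left e1 hC0)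
      have : 1 - Real.exp s₁ ^ 2 ≠ 0 := by linarith
      rw [hC]; field_simp
    have e3 := mul_le_mul_of_nonneg_right e2 (Real.exp_pos (C * s)).le
    linarith
  have hθ : 0 < (p - 1) / (p + 1) := div_pos (by linarith) (by linarith)
  have hev : ∀ᶠ s in atBot, Z s ^ 2 < (p - 1) / (p + 1) := by
    have := hlim.pow 2
    exact this.eventually (gt_mem_nhds (by simpa using hθ))
  obtain ⟨s, hsZ, hs⟩ := (hev.and (eventually_le_atBot s₁)).exists
  have hle := hmono (show s ∈ Iic s₁ from hs) self_mem_Iic hs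
  have hE1 : energy K p Z Z₁ s₁ - m = 0 := by
    simp only [energy, h1, h0, hm]
    simp
  simp only [hE1, zero_mul] at hle
  have hle' : energy K p Z Z₁ s - m ≤ 0 := by
    by_contra! hcon
    exact absurd hle (not_le.2 (mul_pos hcon (Real.exp_pos _)))
  have hx := exp_sq_lt_one (hs.trans_lt hs₁)
  have g1 : 0 ≤ (1 - Real.exp s ^ 2) * Z₁ s ^ 2 / 2 :=
    div_nonneg (mul_nonneg (by linarith) (sq_nonneg _)) (by norm_num)
  have g2 : 0 ≤ |Z s| ^ (p + 1) / (p + 1) :=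
    div_nonneg (Real.rpow_nonneg (abs_nonneg _) _) (by linarith)
  have g3 : (1 / (p + 1) - 1 / 2) = -((p - 1) / (p + 1)) / 2 := by
    have : p + 1 ≠ 0 := by linarith
    field_simp; ring
  have g4 : 0 < K * (|Z s| ^ (p + 1) / (p + 1) - Z s ^ 2 / 2 - (1 / (p + 1) - 1 / 2)) :=
    mul_pos hK (by rw [g3]; linarith)
  unfold energy at hle'
  linarith

/-- Negative energy keeps a positive solution away from `0`. -/
lemma lower_bound_of_energy (h : LogProfile B K p Z Z₁ Z₂) (hB : 0 < B) (hK : 0 < K)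
    (hp : 1 < p) {a ε : ℝ} (hε : 0 < ε) (hE : energy K p Z Z₁ a ≤ -ε) (hZ : 0 < Z a)
    {s : ℝ} (has : a ≤ s) (hs : s < 0) : Real.sqrt (2 * ε / K) ≤ Z s := by
  have key : ∀ t, a ≤ t → t < 0 → 2 * ε / K ≤ Z t ^ 2 := by
    intro t hat ht
    have h1 := (h.antitoneOn_energy hB hp (show a ∈ Iio 0 from hat.trans_lt ht)
      (show t ∈ Iio 0 from ht) hat).trans hE
    have hx := exp_sq_lt_one ht
    have g1 : 0 ≤ (1 - Real.exp t ^ 2) * Z₁ t ^ 2 / 2 :=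
      div_nonneg (mul_nonneg (by linarith) (sq_nonneg _)) (by norm_num)
    have g2 : 0 ≤ K * (|Z t| ^ (p + 1) / (p + 1)) :=
      mul_nonneg hK.le (div_nonneg (Real.rpow_nonneg (abs_nonneg _) _) (by linarith))
    rw [div_le_iff₀ hK]
    unfold energy at h1
    linarith
  have hpos : 0 ≤ Z s := by
    by_contra! hneg
    have hcont : ContinuousOn Z (Icc a s) := fun t ht =>
      (h.deriv_fst t (ht.2.trans_lt hs)).continuousAt.continuousWithinAt
    obtain ⟨y, hy, hy0⟩ := intermediate_value_Icc' has hcont ⟨hneg.le, hZ.le⟩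
    have := key y hy.1 (hy.2.trans_lt hs)
    rw [hy0] at this
    have : 0 < 2 * ε / K := by positivity
    norm_num at *
    linarith
  exact Real.sqrt_le_iff.2 ⟨hpos, key s has hs⟩

/-- `ϑ` is a continuous angle of the curve `(Z - 1, Z₁)`. -/
structure IsAngle (Z Z₁ ϑ : ℝ → ℝ) : Prop where
  cont : ContinuousOn ϑ (Iio 0)
  tan_eq : ∀ s < 0, Z s ≠ 1 → Real.tan (ϑ s) = Z₁ s / (Z s - 1)
  half_iff : ∀ s < 0, (∃ k : ℤ, ϑ s = Real.pi / 2 + k * Real.pi) ↔ Z s = 1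
  transversal : ∀ s < 0, Z s = 1 → Z₁ s ≠ 0

/-- The angle crosses the vertical direction downwards. -/
lemma IsAngle.crossing (h : LogProfile B K p Z Z₁ Z₂) {ϑ : ℝ → ℝ} (hϑ : IsAngle Z Z₁ ϑ)
    {s : ℝ} (hs : s < 0) {k : ℤ} (hk : ϑ s = Real.pi / 2 + k * Real.pi) :
    (∀ᶠ t in nhdsWithin s (Ioi s), ϑ t < ϑ s) ∧ ∀ᶠ t in nhdsWithin s (Iio s), ϑ s < ϑ t := by
  have hZ1 : Z s = 1 := (hϑ.half_iff s hs).1 ⟨k, hk⟩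
  have hnd := hϑ.transversal s hs hZ1
  have hpi := Real.pi_pos
  have hslope : Tendsto (fun t => slope Z s t * Z₁ t) (nhdsWithin s {s}ᶜ)
      (nhds (Z₁ s * Z₁ s)) :=
    (hasDerivAt_iff_tendsto_slope.1 (h.deriv_fst s hs)).mul
      ((h.deriv_snd s hs).continuousAt.tendsto.mono_left nhdsWithin_le_nhds)
  have hev := hslope.eventually (lt_mem_nhds (mul_self_pos.2 hnd))
  have hcont : ContinuousAt ϑ s := hϑ.cont.continuousAt (Iio_mem_nhds hs)
  have hnear : ∀ᶠ t in nhds s, |ϑ t - ϑ s| < Real.pi / 2 := by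
    have := Metric.tendsto_nhds.1 hcont.tendsto (Real.pi / 2) (by positivity)
    simpa [Real.dist_eq] using this
  have hneg : ∀ᶠ t in nhds s, t < 0 := Iio_mem_nhds hs
  constructor
  · filter_upwards [hev.filter_mono (nhdsWithin_mono s (fun t ht => ne_of_gt ht)),
      hnear.filter_mono nhdsWithin_le_nhds, hneg.filter_mono nhdsWithin_le_nhds,
      self_mem_nhdsWithin] with t ht hnt ht0 hts
    have hts' : 0 < t - s := sub_pos.2 hts
    rw [slope_def_field, hZ1, div_mul_eq_mul_div, div_pos_iff_of_pos_right hts'] at ht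
    have hne : Z t ≠ 1 := by rintro h1; simp [h1] at ht
    have htan := hϑ.tan_eq t ht0 hne
    have hpos : 0 < Real.tan (ϑ t) := by
      rw [htan]
      have : Z₁ t / (Z t - 1) = (Z t - 1) * Z₁ t / (Z t - 1) ^ 2 := by
        have := sub_ne_zero.2 hne
        field_simp
      rw [this]
      exact div_pos ht (sq_pos_of_ne_zero (sub_ne_zero.2 hne))
    by_contra! hge
    rw [abs_lt] at hnt
    rw [← Real.tan_sub_int_mul_pi _ (k + 1)] at hpos
    refine absurd hpos (not_lt.2 (Real.tan_nonpos_of_nonpos_of_neg_pi_div_two_le ?_ ?_)) <;>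
    · push_cast; linarith
  · filter_upwards [hev.filter_mono (nhdsWithin_mono s (fun t ht => ne_of_lt ht)),
      hnear.filter_mono nhdsWithin_le_nhds, hneg.filter_mono nhdsWithin_le_nhds,
      self_mem_nhdsWithin] with t ht hnt ht0 hts
    have hts' : t - s < 0 := sub_neg.2 hts
    rw [slope_def_field, hZ1, div_mul_eq_mul_div, div_pos_iff] at ht
    have ht' : (Z t - 1) * Z₁ t < 0 := by
      rcases ht with ⟨-, hh⟩ | ⟨hh, -⟩
      · linarith
      · exact hh
    have hne : Z t ≠ 1 := by rintro h1; simp [h1] at ht'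
    have htan := hϑ.tan_eq t ht0 hne
    have hpos : Real.tan (ϑ t) < 0 := by
      rw [htan]
      have : Z₁ t / (Z t - 1) = (Z t - 1) * Z₁ t / (Z t - 1) ^ 2 := by
        have := sub_ne_zero.2 hne
        field_simp
      rw [this]
      exact div_neg_of_neg_of_pos ht' (sq_pos_of_ne_zero (sub_ne_zero.2 hne))
    by_contra! hge
    rw [abs_lt] at hnt
    rw [← Real.tan_sub_int_mul_pi _ k] at hpos
    refine absurd hpos (not_lt.2 (Real.tan_nonneg_of_nonneg_of_le_pi_div_two ?_ ?_)) <;>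
    linarith

lemma IsAngle.barrier (h : LogProfile B K p Z Z₁ Z₂) {ϑ : ℝ → ℝ} (hϑ : IsAngle Z Z₁ ϑ)
    {a s : ℝ} (has : a ≤ s) (hs : s < 0) {k : ℤ} (hk : ϑ a < Real.pi / 2 + k * Real.pi) :
    ϑ s < Real.pi / 2 + k * Real.pi := by
  by_contra! hge
  set L := Real.pi / 2 + k * Real.pi with hL
  have hcont : ContinuousOn ϑ (Icc a s) := hϑ.cont.mono fun t ht => ht.2.trans_lt hs
  have hcl : IsCompact (Icc a s ∩ ϑ ⁻¹' {L}) :=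
    isCompact_Icc.of_isClosed_subset
      (hcont.preimage_isClosed_of_isClosed isClosed_Icc isClosed_singleton) inter_subset_left
  obtain ⟨y, hy, hyL⟩ := intermediate_value_Icc has hcont ⟨hk.le, hge⟩
  obtain ⟨s₁, ⟨hs₁, hs₁L⟩, hmin⟩ := hcl.exists_isLeast ⟨y, hy, hyL⟩
  have hs₁L' : ϑ s₁ = L := hs₁L
  have has₁ : a < s₁ := lt_of_le_of_ne hs₁.1 (by rintro rfl; linarith)
  have hev := (IsAngle.crossing h hϑ (hs₁.2.trans_lt hs) (hs₁L'.trans hL)).2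
  obtain ⟨t, ht, hta⟩ := (hev.and (Ioo_mem_nhdsLT has₁)).exists
  rw [hs₁L'] at ht
  obtain ⟨y, hy, hyL⟩ := intermediate_value_Icc hta.1.le
    (hcont.mono (Icc_subset_Icc le_rfl (hta.2.le.trans hs₁.2))) ⟨hk.le, ht.le⟩
  have := hmin ⟨⟨hy.1, hy.2.trans (hta.2.le.trans hs₁.2)⟩, hyL⟩
  linarith [hy.2, hta.2]

lemma IsAngle.rotation (h : LogProfile B K p Z Z₁ Z₂) {ϑ : ℝ → ℝ} (hϑ : IsAngle Z Z₁ ϑ)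
    {σ T : ℝ} (hσ : σ < 0) (hT : 0 < T) {a₀ : ℝ}
    (hcross : ∀ a, a₀ ≤ a → a + T ≤ σ → ∃ s ∈ Icc a (a + T), Z s = 1)
    {k : ℤ} (hk : ϑ a₀ < Real.pi / 2 + k * Real.pi) (n : ℕ) (hn : a₀ + n * (T + 1) ≤ σ) :
    ∃ s ∈ Icc a₀ (a₀ + n * (T + 1)), ϑ s < Real.pi / 2 + ((k - n : ℤ) : ℝ) * Real.pi := by
  have hpi := Real.pi_pos
  induction n with
  | zero => exact ⟨a₀, by simp, by simpa using hk⟩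
  | succ n ih =>
    push_cast at hn
    obtain ⟨a, ha, hka⟩ := ih (by linarith)
    obtain ⟨s, hs, hZ⟩ := hcross a ha.1 (by linarith [ha.2])
    have hs0 : s < 0 := by linarith [hs.2, ha.2]
    obtain ⟨j, hj⟩ := (hϑ.half_iff s hs0).2 hZ
    have hlt := IsAngle.barrier h hϑ hs.1 hs0 hka
    have hjk : j < k - n := by
      rw [hj] at hlt
      have : (j : ℝ) * Real.pi < ((k - n : ℤ) : ℝ) * Real.pi := by linarith
      exact_mod_cast lt_of_mul_lt_mul_right this hpi.le
    obtain ⟨t, ht, hts⟩ := ((IsAngle.crossing h hϑ hs0 hj).1.and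
      (Ioo_mem_nhdsGT (lt_add_one s))).exists
    refine ⟨t, ⟨by linarith [ha.1, hs.1, hts.1], ?_⟩, ?_⟩
    · push_cast; linarith [ha.2, hs.2, hts.2]
    · refine ht.trans_le ?_
      rw [hj]
      have : (j : ℝ) ≤ ((k - (n + 1 : ℕ) : ℤ) : ℝ) := by
        have : j ≤ k - (n + 1 : ℕ) := by push_cast; omega
        exact_mod_cast this
      have := mul_le_mul_of_nonneg_right this hpi.le
      linarith

end LogProfile


/-- `u / u_∞` in the variable `s = log ρ`. -/
noncomputable def logRatio (N : ℕ) (p : ℝ) (v : ℝ → ℝ) (s : ℝ) : ℝ :=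
  Real.exp (alphaP p * s) * v (Real.exp s) / bInf N p

/-- First derivative of `logRatio`. -/
noncomputable def logRatioDeriv (N : ℕ) (p : ℝ) (v : ℝ → ℝ) (s : ℝ) : ℝ :=
  Real.exp (alphaP p * s) * (alphaP p * v (Real.exp s) + Real.exp s * deriv v (Real.exp s))
    / bInf N p

/-- Second derivative of `logRatio`. -/
noncomputable def logRatioDerivTwo (N : ℕ) (p : ℝ) (v : ℝ → ℝ) (s : ℝ) : ℝ :=
  Real.exp (alphaP p * s) * (alphaP p ^ 2 * v (Real.exp s)
    + (2 * alphaP p + 1) * (Real.exp s * deriv v (Real.exp s))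
    + Real.exp s ^ 2 * deriv (deriv v) (Real.exp s)) / bInf N p

section Parameters

variable {N : ℕ} {p : ℝ}

lemma one_lt_of_supercritical (hN : 3 ≤ N) (hp : 1 + 4 / ((N : ℝ) - 2) < p) : 1 < p := by
  have : (3 : ℝ) ≤ N := by exact_mod_cast hN
  have : 0 < 4 / ((N : ℝ) - 2) := div_pos (by norm_num) (by linarith)
  linarith

lemma alphaP_pos (hp : 1 < p) : 0 < alphaP p := div_pos two_pos (by linarith)

lemma alphaP_mul (hp : 1 < p) : alphaP p * (p - 1) = 2 :=
  div_mul_cancel₀ _ (by linarith)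

lemma two_alphaP_lt (hN : 3 ≤ N) (hp : 1 + 4 / ((N : ℝ) - 2) < p) :
    0 < (N : ℝ) - 2 - 2 * alphaP p := by
  have h3 : (3 : ℝ) ≤ N := by exact_mod_cast hN
  have h1 := one_lt_of_supercritical hN hp
  have h4 : 4 / ((N : ℝ) - 2) < p - 1 := by linarith
  rw [div_lt_iff₀ (by linarith)] at h4
  have : alphaP p < ((N : ℝ) - 2) / 2 := by
    rw [alphaP, div_lt_div_iff₀ (by linarith) two_pos]; linarith
  linarith

lemma coupling_pos (hN : 3 ≤ N) (hp : 1 + 4 / ((N : ℝ) - 2) < p) :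
    0 < alphaP p * ((N : ℝ) - 2 - alphaP p) := by
  have h0 := alphaP_pos (one_lt_of_supercritical hN hp)
  exact mul_pos h0 (by linarith [two_alphaP_lt hN hp])

lemma bInf_pos (hN : 3 ≤ N) (hp : 1 + 4 / ((N : ℝ) - 2) < p) : 0 < bInf N p :=
  Real.rpow_pos_of_pos (coupling_pos hN hp) _

lemma bInf_rpow (hN : 3 ≤ N) (hp : 1 + 4 / ((N : ℝ) - 2) < p) :
    bInf N p ^ (p - 1) = alphaP p * ((N : ℝ) - 2 - alphaP p) := by
  have h1 := one_lt_of_supercritical hN hp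
  rw [bInf, ← Real.rpow_mul (coupling_pos hN hp).le]
  have : alphaP p / 2 * (p - 1) = 1 := by linarith [alphaP_mul h1]
  rw [this, Real.rpow_one]

/-- Below the Joseph–Lundgren exponent the linearization at `u_∞` oscillates. -/
lemma discriminant_neg (hN : 3 ≤ N) (hp : 1 + 4 / ((N : ℝ) - 2) < p)
    (hpJL : N ≤ 10 ∨ p < 1 + 4 / ((N : ℝ) - 4 - 2 * Real.sqrt ((N : ℝ) - 1))) :
    ((N : ℝ) - 2 - 2 * alphaP p) ^ 2 <
      4 * (alphaP p * ((N : ℝ) - 2 - alphaP p) * (p - 1)) := by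
  have h1 := one_lt_of_supercritical hN hp
  have h0 := alphaP_pos h1
  have hy := two_alphaP_lt hN hp
  have hα := alphaP_mul h1
  have e : 4 * (alphaP p * ((N : ℝ) - 2 - alphaP p) * (p - 1))
      = 8 * ((N : ℝ) - 2 - alphaP p) := by linear_combination 4 * ((N : ℝ) - 2 - alphaP p) * hα
  rw [e]
  have h3 : (3 : ℝ) ≤ N := by exact_mod_cast hN
  by_cases hN10 : N ≤ 10
  · have h10 : (N : ℝ) ≤ 10 := by exact_mod_cast hN10
    nlinarith
  · have hlt := hpJL.resolve_left hN10
    have h11 : (11 : ℝ) ≤ N := by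
      have : 11 ≤ N := by omega
      exact_mod_cast this
    set r := Real.sqrt ((N : ℝ) - 1) with hr
    have hr2 : r ^ 2 = N - 1 := Real.sq_sqrt (by linarith)
    have hr1 : 1 < r := by
      rw [hr, Real.lt_sqrt (by norm_num)]; linarith
    have hD : 0 < (N : ℝ) - 4 - 2 * r := by
      have : r < ((N : ℝ) - 4) / 2 := by
        rw [hr, Real.sqrt_lt' (by linarith)]; nlinarith
      linarith
    have h4 : p - 1 < 4 / ((N : ℝ) - 4 - 2 * r) := by linarith
    rw [lt_div_iff₀ hD] at h4
    have h5 : (N : ℝ) - 4 - 2 * r < 2 * alphaP p := by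
      by_contra! hcon
      nlinarith [mul_le_mul_of_nonneg_left hcon (sub_pos.2 h1).le]
    have h6 : ((N : ℝ) - 4 - 2 * alphaP p) ^ 2 < (2 * r) ^ 2 :=
      sq_lt_sq' (by linarith) (by linarith)
    nlinarith

end Parameters

section Profile

variable {N : ℕ} {p : ℝ} {v : ℝ → ℝ}

lemma hasDerivAt_of_contDiffOn (hv : ContDiffOn ℝ 2 v (Ico 0 1)) {ρ : ℝ} (hρ : ρ ∈ Ioo (0 : ℝ) 1) :
    HasDerivAt v (deriv v ρ) ρ ∧ HasDerivAt (deriv v) (deriv (deriv v) ρ) ρ := by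
  have h : ContDiffOn ℝ 2 v (Ioo 0 1) := hv.mono Ioo_subset_Ico_self
  have hn := isOpen_Ioo.mem_nhds hρ
  refine ⟨((h.differentiableOn (by norm_num)).differentiableAt hn).hasDerivAt, ?_⟩
  have h' : ContDiffOn ℝ 1 (deriv v) (Ioo 0 1) :=
    h.deriv_of_isOpen isOpen_Ioo (by norm_num)
  exact ((h'.differentiableOn (by norm_num)).differentiableAt hn).hasDerivAt

lemma exp_mem_Ioo {s : ℝ} (hs : s < 0) : Real.exp s ∈ Ioo (0 : ℝ) 1 :=
  ⟨Real.exp_pos s, by simpa using Real.exp_lt_exp.2 hs⟩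

theorem logProfile_logRatio (hN : 3 ≤ N) (hp : 1 + 4 / ((N : ℝ) - 2) < p)
    (hv : ContDiffOn ℝ 2 v (Ico 0 1)) (hsol : IsSolOn N p v (Ioo 0 1)) :
    LogProfile ((N : ℝ) - 2 - 2 * alphaP p) (alphaP p * ((N : ℝ) - 2 - alphaP p)) p
      (logRatio N p v) (logRatioDeriv N p v) (logRatioDerivTwo N p v) := by
  have hp1 := one_lt_of_supercritical hN hp
  have hα := alphaP_mul hp1
  have hb := bInf_pos hN hp
  have hexpα : ∀ s : ℝ, HasDerivAt (fun s => Real.exp (alphaP p * s))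
      (Real.exp (alphaP p * s) * (alphaP p * 1)) s := fun s =>
    ((hasDerivAt_id s).const_mul (alphaP p)).exp
  refine ⟨fun s hs => ?_, fun s hs => ?_, fun s hs => ?_⟩
  · have h1 := (hasDerivAt_of_contDiffOn hv (exp_mem_Ioo hs)).1.comp s (Real.hasDerivAt_exp s)
    refine (((hexpα s).mul h1).div_const (bInf N p)).congr_deriv ?_
    simp only [logRatioDeriv, Function.comp]
    ring
  · obtain ⟨h1, h2⟩ := hasDerivAt_of_contDiffOn hv (exp_mem_Ioo hs)
    have h1' := h1.comp s (Real.hasDerivAt_exp s)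
    have h2' := h2.comp s (Real.hasDerivAt_exp s)
    refine (((hexpα s).mul ((h1'.const_mul (alphaP p)).add
      ((Real.hasDerivAt_exp s).mul h2'))).div_const (bInf N p)).congr_deriv ?_
    simp only [logRatioDerivTwo, Function.comp, Pi.add_apply, Pi.mul_apply]
    ring
  · have he := hsol _ (exp_mem_Ioo hs)
    have hK := bInf_rpow hN hp
    have hx := Real.exp_pos s
    have habs : alphaP p * ((N : ℝ) - 2 - alphaP p) * |logRatio N p v s| ^ (p - 1)
        = Real.exp s ^ 2 * |v (Real.exp s)| ^ (p - 1) := by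
      rw [logRatio, abs_div, abs_mul, abs_of_pos hb, abs_of_pos (Real.exp_pos _),
        Real.div_rpow (by positivity) hb.le, Real.mul_rpow (by positivity) (by positivity), hK,
        ← Real.exp_mul, ← Real.exp_nat_mul]
      have : alphaP p * s * (p - 1) = (2 : ℕ) * s := by push_cast; linear_combination s * hα
      rw [this]
      have := (coupling_pos hN hp).ne'
      field_simp
      exact mul_div_cancel_left₀ _ this
    have hsplit : alphaP p * ((N : ℝ) - 2 - alphaP p)
        * (|logRatio N p v s| ^ (p - 1) * logRatio N p v s - logRatio N p v s)
        = Real.exp s ^ 2 * |v (Real.exp s)| ^ (p - 1) * logRatio N p v s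
          - alphaP p * ((N : ℝ) - 2 - alphaP p) * logRatio N p v s := by
      rw [← habs]; ring
    rw [hsplit]
    simp only [logRatio, logRatioDeriv, logRatioDerivTwo]
    generalize |v (Real.exp s)| ^ (p - 1) = A at he
    field_simp at he ⊢
    linear_combination Real.exp (alphaP p * s) * Real.exp s * he

lemma tendsto_logRatio_atBot (hp : 1 < p) (hv : ContDiffOn ℝ 2 v (Ico 0 1)) :
    Tendsto (logRatio N p v) atBot (nhds 0) := by
  have h1 : Tendsto (fun s => v (Real.exp s)) atBot (nhds (v 0)) := by
    have hc : ContinuousWithinAt v (Ico 0 1) 0 := hv.continuousOn 0 (by simp)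
    refine hc.tendsto.comp (tendsto_nhdsWithin_iff.2 ⟨Real.tendsto_exp_atBot, ?_⟩)
    filter_upwards [eventually_lt_atBot 0] with s hs
    exact Ioo_subset_Ico_self (exp_mem_Ioo hs)
  have h2 : Tendsto (fun s => Real.exp (alphaP p * s)) atBot (nhds 0) :=
    Real.tendsto_exp_atBot.comp (tendsto_id.const_mul_atBot (alphaP_pos hp))
  have h := (h2.mul h1).div_const (bInf N p)
  simp only [zero_mul, zero_div] at h
  exact h

/-- Gradient bound near the centre, with the natural scaling in `c = v 0`. -/
lemma exists_gradient_bound (hN : 3 ≤ N) (hp : 1 + 4 / ((N : ℝ) - 2) < p) :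
    ∃ C > 0, ∀ (c : ℝ) (v : ℝ → ℝ), 1 ≤ c → ContDiffOn ℝ 2 v (Ico 0 1) →
      IsSolOn N p v (Ioo 0 1) → v 0 = c → derivWithin v (Ici 0) 0 = 0 →
      ∀ ρ ∈ Ioc (0 : ℝ) (1 / 2), |deriv v ρ| ≤ C * c ^ ((p + 1) / 2) ∧
        |v ρ - c| ≤ C * c ^ ((p + 1) / 2) * ρ := by
  have hp1 := one_lt_of_supercritical hN hp
  have hα := alphaP_pos hp1
  have hα2 := two_alphaP_lt hN hp
  have h3 : (3 : ℝ) ≤ N := by exact_mod_cast hN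
  set A := alphaP p * (alphaP p + 1) with hA
  have hA0 : 0 < A := by positivity
  set X := (A * (p + 1)) ^ (1 / (p - 1)) with hX
  have hX0 : 0 ≤ X := by positivity
  have hXp : X ^ (p - 1) = A * (p + 1) := by
    rw [hX, ← Real.rpow_mul (by positivity), one_div_mul_cancel (by linarith), Real.rpow_one]
  set M := A * X ^ 2 / 2 with hM
  have hM0 : 0 ≤ M := by positivity
  have hpot : ∀ y : ℝ, A * y ^ 2 / 2 - |y| ^ (p + 1) / (p + 1) ≤ M := by
    intro y
    have hp2 : 0 < p + 1 := by linarith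
    rcases le_or_gt |y| X with hy | hy
    · have h1 : y ^ 2 ≤ X ^ 2 := sq_le_sq' (by linarith [neg_abs_le y]) (by linarith [le_abs_self y])
      have h2 : 0 ≤ |y| ^ (p + 1) / (p + 1) := by positivity
      have h4 := mul_le_mul_of_nonneg_left h1 hA0.le
      rw [hM]; linarith
    · have h1 : X ^ (p - 1) ≤ |y| ^ (p - 1) := Real.rpow_le_rpow hX0 hy.le (by linarith)
      have h2 : |y| ^ (p + 1) = |y| ^ (p - 1) * y ^ 2 := by
        rw [← sq_abs y, ← Real.rpow_natCast, ← Real.rpow_add (hX0.trans_lt hy)]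
        congr 1; push_cast; ring
      have h4 : A * y ^ 2 ≤ |y| ^ (p + 1) / (p + 1) := by
        rw [le_div_iff₀ hp2, h2]
        have := mul_le_mul_of_nonneg_right h1 (sq_nonneg y)
        rw [hXp] at this
        linarith
      have : 0 ≤ A * y ^ 2 := by positivity
      linarith
  refine ⟨Real.sqrt (3 * (1 / (p + 1) + M)), by positivity, ?_⟩
  intro c v hc hv hsol h0 hd0
  have hc0 : 0 < c := by linarith
  set C := Real.sqrt (3 * (1 / (p + 1) + M)) with hC
  have hC2 : C ^ 2 = 3 * (1 / (p + 1) + M) := Real.sq_sqrt (by positivity)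
  have hC0 : 0 ≤ C := Real.sqrt_nonneg _
  have hcp : (c ^ ((p + 1) / 2)) ^ 2 = c ^ (p + 1) := by
    rw [← Real.rpow_natCast, ← Real.rpow_mul hc0.le]; congr 1; push_cast; ring
  set V := derivWithin v (Ico 0 1) with hV
  have hVcont : ContinuousOn V (Ico 0 1) :=
    hv.continuousOn_derivWithin (uniqueDiffOn_Ico 0 1) (by norm_num)
  have hV0 : V 0 = 0 := by
    have hset : derivWithin v (Ico 0 1) 0 = derivWithin v (Ici 0) 0 := derivWithin_congr_set (by
      filter_upwards [Iio_mem_nhds (one_pos : (0 : ℝ) < 1)] with x hx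
      exact propext ⟨fun h => h.1, fun h => ⟨h, hx⟩⟩)
    rw [hV, hset, hd0]
  have hVd : ∀ x ∈ Ioo (0 : ℝ) 1, V x = deriv v x := fun x hx =>
    derivWithin_of_mem_nhds (Filter.mem_of_superset (isOpen_Ioo.mem_nhds hx) Ioo_subset_Ico_self)
  have grad : ∀ ρ ∈ Ioc (0 : ℝ) (1 / 2), |deriv v ρ| ≤ C * c ^ ((p + 1) / 2) := by
    intro ρ hρ
    have hanti : AntitoneOn (fun x => (1 - x ^ 2) * V x ^ 2 / 2
        + (|v x| ^ (p + 1) / (p + 1) - A * v x ^ 2 / 2)) (Icc 0 ρ) := by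
      have hsub : Icc 0 ρ ⊆ Ico (0 : ℝ) 1 := fun x hx => ⟨hx.1, by linarith [hx.2, hρ.2]⟩
      have hVc := hVcont.mono hsub
      have hvc := hv.continuousOn.mono hsub
      refine antitoneOn_of_hasDerivWithinAt_nonpos (convex_Icc _ _)
        (f' := fun x => -(((N : ℝ) - 1) / x - (2 * alphaP p + 1) * x) * deriv v x ^ 2)
        ?_ (fun x hx => ?_) (fun x hx => ?_)
      · have hc1 : ContinuousOn (fun x => |v x| ^ (p + 1)) (Icc 0 ρ) :=
          hvc.abs.rpow_const fun x _ => Or.inr (by linarith)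
        fun_prop
      · rw [interior_Icc] at hx
        have hx1 : x ∈ Ioo (0 : ℝ) 1 := ⟨hx.1, by linarith [hx.2, hρ.2]⟩
        obtain ⟨h1, h2⟩ := hasDerivAt_of_contDiffOn hv hx1
        have h2' : HasDerivAt V (deriv (deriv v) x) x := by
          refine h2.congr_of_eventuallyEq ?_
          filter_upwards [isOpen_Ioo.mem_nhds hx1] with y hy using hVd y hy
        have h5 := (hasDerivAt_abs_rpow (v x) (p := p + 1) (by linarith)).comp x h1
        have h6 := (((((hasDerivAt_id x).pow 2).const_sub 1).mul (h2'.pow 2)).div_const 2).add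
          ((h5.div_const (p + 1)).sub (((h1.pow 2).const_mul A).div_const 2))
        refine (h6.congr_deriv ?_).hasDerivWithinAt
        have he := hsol x hx1
        have hp3 : p + 1 - 2 = p - 1 := by ring
        have hp2 : p + 1 ≠ 0 := by linarith
        have hx0 : x ≠ 0 := hx.1.ne'
        simp only [hp3, Pi.pow_apply, hVd x hx1, id]
        rw [← hA] at he
        generalize |v x| ^ (p - 1) = a at he
        field_simp at he ⊢
        push_cast
        ring_nf at he ⊢
        linear_combination 2 * deriv v x * he
      · rw [interior_Icc] at hx
        have hx1 : x < 1 := by linarith [hx.2, hρ.2]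
        have : (2 * alphaP p + 1) * x ≤ ((N : ℝ) - 1) / x := by
          rw [le_div_iff₀ hx.1]
          have hxx : x * x ≤ 1 := by nlinarith [hx.1]
          have := mul_le_mul_of_nonneg_left hxx (show 0 ≤ 2 * alphaP p + 1 by linarith)
          linarith
        have := mul_nonneg (sub_nonneg.2 this) (sq_nonneg (deriv v x))
        linarith
    have h1 := hanti (left_mem_Icc.2 hρ.1.le) (right_mem_Icc.2 hρ.1.le) hρ.1.le
    have hρ1 : ρ ∈ Ioo (0 : ℝ) 1 := ⟨hρ.1, by linarith [hρ.2]⟩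
    simp only [hVd ρ hρ1, hV0, h0, abs_of_pos hc0] at h1
    have h2 := hpot (v ρ)
    have h4 : 0 ≤ A * c ^ 2 / 2 := by positivity
    have h5 : M ≤ M * c ^ (p + 1) :=
      le_mul_of_one_le_right hM0 (Real.one_le_rpow hc (by linarith))
    have h6 : 3 / 4 * deriv v ρ ^ 2 ≤ (1 - ρ ^ 2) * deriv v ρ ^ 2 := by
      have := hρ.2
      have := hρ.1
      exact mul_le_mul_of_nonneg_right (by nlinarith) (sq_nonneg _)
    have h7 : c ^ (p + 1) / (p + 1) = 1 / (p + 1) * c ^ (p + 1) := by ring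
    have h8 : 0 ≤ (1 / (p + 1) + M) * c ^ (p + 1) := by positivity
    refine abs_le_of_sq_le_sq ?_ (by positivity)
    rw [mul_pow, hC2, hcp]
    linarith
  intro ρ hρ
  refine ⟨grad ρ hρ, ?_⟩
  have hsub : Icc 0 ρ ⊆ Ico (0 : ℝ) 1 := fun x hx => ⟨hx.1, by linarith [hx.2, hρ.2]⟩
  have hdv : DifferentiableOn ℝ v (Ico 0 1) := hv.differentiableOn (by norm_num)
  have := norm_image_sub_le_of_norm_deriv_le_segment' (f := v) (f' := V) (a := 0) (b := ρ)
    (C := C * c ^ ((p + 1) / 2))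
    (fun x hx => ((hdv x (hsub hx)).hasDerivWithinAt).mono hsub)
    (fun x hx => by
      rcases eq_or_lt_of_le hx.1 with h | h
      · rw [← h, hV0, norm_zero]; positivity
      · rw [hVd x ⟨h, by linarith [hx.2, hρ.2]⟩]
        exact grad x ⟨h, by linarith [hx.2, hρ.2]⟩)
    ρ (right_mem_Icc.2 hρ.1.le)
  simpa [h0, Real.norm_eq_abs] using this

set_option maxHeartbeats 400000 in
/-- Uniformly negative energy at a logarithmic position tending to `-∞` with `c`. -/
lemma exists_initial_energy (hN : 3 ≤ N) (hp : 1 + 4 / ((N : ℝ) - 2) < p) :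
    ∃ ε > (0 : ℝ), ∃ l : ℝ, ∀ (c : ℝ) (v : ℝ → ℝ), 1 ≤ c → ContDiffOn ℝ 2 v (Ico 0 1) →
      IsSolOn N p v (Ioo 0 1) → v 0 = c → derivWithin v (Ici 0) 0 = 0 →
      0 < logRatio N p v (l - (p - 1) / 2 * Real.log c) ∧
      LogProfile.energy (alphaP p * ((N : ℝ) - 2 - alphaP p)) p (logRatio N p v) (logRatioDeriv N p v)
        (l - (p - 1) / 2 * Real.log c) ≤ -ε := by
  obtain ⟨C, hC0, hC⟩ := exists_gradient_bound hN hp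
  have hp1 := one_lt_of_supercritical hN hp
  have hα := alphaP_pos hp1
  have hα2 := two_alphaP_lt hN hp
  have hαp := alphaP_mul hp1
  have hb := bInf_pos hN hp
  have hbK := bInf_rpow hN hp
  have hK := coupling_pos hN hp
  have hgap : 0 < alphaP p * ((N : ℝ) - 2 - alphaP p) - alphaP p ^ 2 := by
    nlinarith [mul_pos hα hα2]
  set α := alphaP p with hαdef
  set K := α * ((N : ℝ) - 2 - α) with hKdef
  set b := bInf N p with hbdef
  obtain ⟨η, hη, hη0, hη1⟩ : ∃ η : ℝ, ((α * (1 + C * η) + C * η) ^ 2 / 2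
      - K * (1 - C * η) ^ 2 / 2 + η ^ 2 * (2 ^ (p + 1) / (p + 1)) < -((K - α ^ 2) / 4) ∧
      C * η < 1 / 2) ∧ 0 < η ∧ η < 1 / 2 := by
    have hc1 : ContinuousAt (fun η : ℝ => (α * (1 + C * η) + C * η) ^ 2 / 2
      - K * (1 - C * η) ^ 2 / 2 + η ^ 2 * (2 ^ (p + 1) / (p + 1))) 0 := by fun_prop
    have hc2 : ContinuousAt (fun η : ℝ => C * η) 0 := by fun_prop
    have e1 := hc1.eventually_lt (continuousAt_const (y := -((K - α ^ 2) / 4)))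
      (by norm_num; linarith)
    have e2 := hc2.eventually_lt (continuousAt_const (y := (1 / 2 : ℝ))) (by norm_num)
    have e3 : ∀ᶠ t in nhdsWithin (0 : ℝ) (Ioi 0), t ∈ Ioo (0 : ℝ) (1 / 2) :=
      Ioo_mem_nhdsGT (by norm_num)
    obtain ⟨η, h, h'⟩ := (((e1.and e2).filter_mono nhdsWithin_le_nhds).and e3).exists
    exact ⟨η, h, h'⟩
  obtain ⟨hη, hCη⟩ := hη
  set m := η ^ α / b with hm
  have hm0 : 0 < m := by positivity
  refine ⟨m ^ 2 * ((K - α ^ 2) / 4), mul_pos (by positivity) (by linarith), Real.log η, ?_⟩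
  intro c v hc hv hsol h0 hd0
  have hc0 : 0 < c := by linarith
  set s := Real.log η - (p - 1) / 2 * Real.log c with hs
  set h := c ^ ((p - 1) / 2) with hh
  have hh1 : 1 ≤ h := Real.one_le_rpow hc (by linarith)
  have hh0 : 0 < h := by linarith
  have hexp : Real.exp s = η / h := by
    rw [hs, Real.exp_sub, Real.exp_log hη0, hh, Real.rpow_def_of_pos hc0, mul_comm (Real.log c)]
  have hexpα : Real.exp (α * s) = η ^ α / c := by
    have : α * s = Real.log η * α - Real.log c := by rw [hs]; linear_combination (-Real.log c / 2) * hαp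
    rw [this, Real.exp_sub, Real.exp_log hc0, Real.rpow_def_of_pos hη0]
  have hρ0 : 0 < Real.exp s := Real.exp_pos s
  have hρη : Real.exp s ≤ η := by rw [hexp]; exact div_le_self hη0.le hh1
  obtain ⟨hg, hval⟩ := hC c v hc hv hsol h0 hd0 (Real.exp s) ⟨hρ0, by linarith⟩
  have hch : c ^ ((p + 1) / 2) = c * h := by
    rw [hh, ← Real.rpow_one_add' hc0.le (by linarith)]; congr 1; ring
  have hhρ : h * Real.exp s = η := by rw [hexp]; field_simp
  set ρ := Real.exp s with hρ
  set y := v ρ / c with hy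
  set d := ρ * deriv v ρ / c with hd
  have hyb : |y - 1| ≤ C * η := by
    have : y - 1 = (v ρ - c) / c := by rw [hy]; field_simp
    rw [this, abs_div, abs_of_pos hc0, div_le_iff₀ hc0]
    refine hval.trans (le_of_eq ?_)
    rw [hch, ← hhρ]; ring
  have hdb : |d| ≤ C * η := by
    rw [hd, abs_div, abs_of_pos hc0, div_le_iff₀ hc0, abs_mul, abs_of_pos hρ0]
    refine (mul_le_mul_of_nonneg_left hg hρ0.le).trans (le_of_eq ?_)
    rw [hch, ← hhρ]; ring
  rw [abs_le] at hyb hdb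
  have hZ : logRatio N p v s = m * y := by
    simp only [logRatio, ← hαdef, hexpα, ← hbdef, ← hρ, hm, hy]; field_simp
  have hZ₁ : logRatioDeriv N p v s = m * (α * y + d) := by
    simp only [logRatioDeriv, ← hαdef, hexpα, ← hbdef, ← hρ, hm, hy, hd]; field_simp
  have hy0 : 0 < y := by linarith
  have hKm : K * m ^ (p - 1) = η ^ 2 := by
    rw [hm, Real.div_rpow (by positivity) hb.le, hbK, ← Real.rpow_mul hη0.le, hαp]
    rw [mul_div_cancel₀ _ hK.ne']
    exact_mod_cast Real.rpow_natCast η 2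
  have hpow : K * (|m * y| ^ (p + 1) / (p + 1)) ≤ m ^ 2 * (η ^ 2 * (2 ^ (p + 1) / (p + 1))) := by
    have e1 : m ^ (p + 1) = m ^ 2 * m ^ (p - 1) := by
      rw [← Real.rpow_natCast m 2, ← Real.rpow_add hm0]; congr 1; push_cast; ring
    have e2 : y ^ (p + 1) ≤ 2 ^ (p + 1) := Real.rpow_le_rpow hy0.le (by linarith) (by linarith)
    rw [abs_of_pos (mul_pos hm0 hy0), Real.mul_rpow hm0.le hy0.le, e1, ← hKm]
    have : K * (m ^ 2 * m ^ (p - 1) * y ^ (p + 1) / (p + 1))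
        = m ^ 2 * (K * m ^ (p - 1) * (y ^ (p + 1) / (p + 1))) := by ring
    rw [this]
    have : 0 ≤ K * m ^ (p - 1) := by positivity
    have : 0 < p + 1 := by linarith
    gcongr
  refine ⟨by rw [hZ]; positivity, ?_⟩
  have hx : 0 ≤ ρ ^ 2 := by positivity
  have q1 : (α * y + d) ^ 2 ≤ (α * (1 + C * η) + C * η) ^ 2 := by
    have hlow : 0 ≤ α * y := by positivity
    have hup : α * y ≤ α * (1 + C * η) := mul_le_mul_of_nonneg_left (by linarith) hα.le
    have h6 : 0 ≤ α * (1 + C * η) := by positivity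
    exact sq_le_sq' (by linarith) (by linarith)
  have q2 : K * (1 - C * η) ^ 2 ≤ K * y ^ 2 := by
    have : (1 - C * η) ^ 2 ≤ y ^ 2 := sq_le_sq' (by linarith) (by linarith)
    exact mul_le_mul_of_nonneg_left this hK.le
  have q3 : (1 - ρ ^ 2) * (α * y + d) ^ 2 ≤ (α * y + d) ^ 2 := by
    linarith [mul_nonneg hx (sq_nonneg (α * y + d))]
  have q4 := mul_le_mul_of_nonneg_left (show (1 - ρ ^ 2) * (α * y + d) ^ 2 / 2 - K * y ^ 2 / 2
      + η ^ 2 * (2 ^ (p + 1) / (p + 1)) ≤ -((K - α ^ 2) / 4) by linarith) (sq_nonneg m)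
  unfold LogProfile.energy
  rw [hZ, hZ₁, ← hρ, mul_pow, mul_pow]
  have q5 : (1 - ρ ^ 2) * (m ^ 2 * (α * y + d) ^ 2) / 2
      + K * (|m * y| ^ (p + 1) / (p + 1) - m ^ 2 * y ^ 2 / 2)
      = m ^ 2 * ((1 - ρ ^ 2) * (α * y + d) ^ 2 / 2 - K * y ^ 2 / 2)
        + K * (|m * y| ^ (p + 1) / (p + 1)) := by ring
  rw [q5]
  rw [mul_add] at q4
  linarith

lemma wFun_eq_logRatio (u : ℝ → ℝ → ℝ) (c : ℝ) {ρ : ℝ} (hρ : 0 < ρ) :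
    wFun N p u c ρ = logRatio N p (u c) (Real.log ρ) - 1 := by
  have : ρ ^ (-(alphaP p)) = (Real.exp (alphaP p * Real.log ρ))⁻¹ := by
    rw [Real.rpow_def_of_pos hρ, ← Real.exp_neg]; congr 1; ring
  rw [wFun, uInf, logRatio, this, Real.exp_log hρ]
  field_simp

lemma exp_mul_deriv_wFun (hN : 3 ≤ N) (hp : 1 + 4 / ((N : ℝ) - 2) < p) (u : ℝ → ℝ → ℝ) (c : ℝ)
    (hv : ContDiffOn ℝ 2 (u c) (Ico 0 1)) (hsol : IsSolOn N p (u c) (Ioo 0 1))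
    {s : ℝ} (hs : s < 0) :
    Real.exp s * deriv (wFun N p u c) (Real.exp s) = logRatioDeriv N p (u c) s := by
  have h := (logProfile_logRatio hN hp hv hsol).deriv_fst s hs
  have hpos := Real.exp_pos s
  rw [← Real.log_exp s] at h
  have h1 := (h.comp (Real.exp s) (Real.hasDerivAt_log hpos.ne')).sub_const 1
  have h2 : HasDerivAt (wFun N p u c)
      (logRatioDeriv N p (u c) (Real.log (Real.exp s)) * (Real.exp s)⁻¹) (Real.exp s) := by
    refine h1.congr_of_eventuallyEq ?_
    filter_upwards [Ioi_mem_nhds hpos] with ρ hρ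
    exact wFun_eq_logRatio u c hρ
  rw [h2.deriv, Real.log_exp]
  field_simp

end Profile


theorem stmt7 (N : ℕ) (p : ℝ) (hN : 3 ≤ N) (hp : 1 + 4 / ((N : ℝ) - 2) < p)
    -- `p < p_JL` (where `p_JL = +∞` for `3 ≤ N ≤ 10`)
    (hpJL : N ≤ 10 ∨ p < 1 + 4 / ((N : ℝ) - 4 - 2 * Real.sqrt ((N : ℝ) - 1)))
    (u : ℝ → ℝ → ℝ)
    (hu : ∀ c : ℝ,
      ContDiffOn ℝ 2 (u c) (Ico 0 1) ∧
      IsSolOn N p (u c) (Ioo 0 1) ∧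
      u c 0 = c ∧
      derivWithin (u c) (Ici 0) 0 = 0)
    (Θ : ℝ → ℝ → ℝ)
    (hΘcont : ContinuousOn (fun q : ℝ × ℝ => Θ q.1 q.2) (Ico 0 1 ×ˢ Ici 0))
    (hΘtan : ∀ ρ ∈ Ico (0 : ℝ) 1, ∀ c : ℝ, 0 ≤ c → wFun N p u c ρ ≠ 0 →
      Real.tan (Θ ρ c) = ρ * deriv (wFun N p u c) ρ / wFun N p u c ρ)
    (hΘhalf : ∀ ρ ∈ Ico (0 : ℝ) 1, ∀ c : ℝ, 0 ≤ c →
      ((∃ k : ℤ, Θ ρ c = Real.pi / 2 + (k : ℝ) * Real.pi) ↔ wFun N p u c ρ = 0))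
    (hΘ0 : ∀ c : ℝ, 0 ≤ c → Θ 0 c = Real.pi) :
    ∀ ρ ∈ Ioo (0 : ℝ) 1, Tendsto (fun c => Θ ρ c) atTop atBot := by
  intro ρ hρ
  have hpi := Real.pi_pos
  have hp1 := one_lt_of_supercritical hN hp
  have hB := two_alphaP_lt hN hp
  have hK := coupling_pos hN hp
  obtain ⟨ε, hε, l, hstart⟩ := exists_initial_energy hN hp
  obtain ⟨σ, hσ, T, hT, hcross⟩ := LogProfile.exists_uniform_crossing hB hK hp1
    (discriminant_neg hN hp hpJL)
    (δ := Real.sqrt (2 * ε / (alphaP p * ((N : ℝ) - 2 - alphaP p)))) (by positivity)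
  have hlogρ : Real.log ρ < 0 := Real.log_neg hρ.1 hρ.2
  rw [tendsto_atBot]
  intro M
  obtain ⟨n, hn⟩ := exists_nat_ge ((Real.pi / 2 + Real.pi - M) / Real.pi)
  rw [div_le_iff₀ hpi] at hn
  have hlog : Tendsto (fun c => (p - 1) / 2 * Real.log c) atTop atTop :=
    Real.tendsto_log_atTop.const_mul_atTop (by linarith)
  filter_upwards [eventually_ge_atTop 1,
    hlog.eventually_ge_atTop (l + n * (T + 1) - min σ (Real.log ρ))] with c hc hlc
  have hc0 : 0 ≤ c := by linarith
  obtain ⟨hv, hsol, h0, hd0⟩ := hu c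
  have hprof := logProfile_logRatio hN hp hv hsol
  obtain ⟨hZa, hEa⟩ := hstart c (u c) hc hv hsol h0 hd0
  set a := l - (p - 1) / 2 * Real.log c with ha
  have han : a + n * (T + 1) ≤ min σ (Real.log ρ) := by linarith
  have hmin0 : min σ (Real.log ρ) < 0 := (min_le_left _ _).trans_lt hσ
  have hnT : 0 ≤ n * (T + 1) := by positivity
  have ha0 : a < 0 := by linarith
  have hcontρ : ContinuousOn (fun x => Θ x c) (Ico 0 1) :=
    hΘcont.comp (f := fun x : ℝ => (x, c)) (by fun_prop) fun x hx => ⟨hx, hc0⟩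
  have hangle : LogProfile.IsAngle (logRatio N p (u c)) (logRatioDeriv N p (u c))
      (fun s => Θ (Real.exp s) c) := by
    refine ⟨?_, fun s hs h1 => ?_, fun s hs => ?_, fun s hs h1 => ?_⟩
    · exact hcontρ.comp Real.continuous_exp.continuousOn
        fun s hs => Ioo_subset_Ico_self (exp_mem_Ioo hs)
    · have hw := wFun_eq_logRatio (N := N) (p := p) u c (Real.exp_pos s)
      rw [Real.log_exp] at hw
      have := hΘtan _ (Ioo_subset_Ico_self (exp_mem_Ioo hs)) c hc0
        (by rw [hw]; exact sub_ne_zero.2 h1)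
      rwa [exp_mul_deriv_wFun hN hp u c hv hsol hs, hw] at this
    · have hw := wFun_eq_logRatio (N := N) (p := p) u c (Real.exp_pos s)
      rw [Real.log_exp] at hw
      rw [hΘhalf _ (Ioo_subset_Ico_self (exp_mem_Ioo hs)) c hc0, hw, sub_eq_zero]
    · exact hprof.deriv_ne_zero_of_eq_one hB hK hp1 (tendsto_logRatio_atBot hp1 hv) hs h1
  have hinit : Θ (Real.exp a) c < Real.pi / 2 + ((1 : ℤ) : ℝ) * Real.pi := by
    have hlim : Tendsto (fun s => Θ (Real.exp s) c) atBot (nhds Real.pi) := by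
      have hcw : ContinuousWithinAt (fun x => Θ x c) (Ico 0 1) 0 := hcontρ 0 (by simp)
      have := hcw.tendsto
      rw [hΘ0 c hc0] at this
      refine this.comp (tendsto_nhdsWithin_iff.2 ⟨Real.tendsto_exp_atBot, ?_⟩)
      filter_upwards [eventually_lt_atBot 0] with s hs
      exact Ioo_subset_Ico_self (exp_mem_Ioo hs)
    have hev : ∀ᶠ s in atBot, Θ (Real.exp s) c < Real.pi / 2 + ((1 : ℤ) : ℝ) * Real.pi :=
      hlim.eventually (gt_mem_nhds (by push_cast; linarith))
    obtain ⟨s, hs, hsa⟩ := (hev.and (eventually_le_atBot a)).exists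
    exact LogProfile.IsAngle.barrier hprof hangle hsa ha0 hs
  obtain ⟨s, hs, hlt⟩ := LogProfile.IsAngle.rotation hprof hangle (σ := min σ (Real.log ρ))
    hmin0 hT (fun t hat htT => hcross _ _ _ hprof t (htT.trans (min_le_left _ _)) fun r hr =>
      hprof.lower_bound_of_energy hB hK hp1 hε hEa hZa (hat.trans hr.1)
        ((hr.2.trans htT).trans_lt hmin0)) hinit n han
  have hfin := LogProfile.IsAngle.barrier hprof hangle
    ((hs.2.trans han).trans (min_le_right _ _)) hlogρ hlt
  simp only [Real.exp_log hρ.1] at hfin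
  push_cast at hfin
  linarith
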